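/- Let 0 < p ≤ 2 and let a, b be real numbers with a > 0 and b ≥ 0. If a^p + (p²/4)·a^{p−2}·b² ≤ 1, then a² + (p/2)·b² ≤ 1. -/

import Mathlib

/-- Elementary inequality: for `0 < p ≤ 2`, `a > 0`, `b ≥ 0`, if
`a^p + (p²/4) a^{p-2} b² ≤ 1` then `a² + (p/2) b² ≤ 1`. -/
theorem bernoulli_consequence (p a b : ℝ) (hp0 : 0 < p) (hp2 : p ≤ 2)
    (ha : 0 < a) (hb : 0 ≤ b)
    (h : a ^ p + (p ^ 2 / 4) * a ^ (p - 2) * b ^ 2 ≤ 1) :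
    a ^ 2 + (p / 2) * b ^ 2 ≤ 1 := by
  set s : ℝ := p ^ 2 / 4 * b ^ 2 / a ^ 2 with hs
  have hs0 : 0 ≤ s := by positivity
  have hfactor : a ^ p * (1 + s) ≤ 1 := by
    rw [Real.rpow_sub ha, Real.rpow_two] at h
    calc a ^ p * (1 + s) = a ^ p + p ^ 2 / 4 * (a ^ p / a ^ 2) * b ^ 2 := by rw [hs]; ring
      _ ≤ 1 := h
  have hbernoulli : 1 + 2 / p * s ≤ (1 + s) ^ (2 / p) :=
    one_add_mul_self_le_rpow_one_add (by linarith) ((one_le_div hp0).2 hp2)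
  calc a ^ 2 + p / 2 * b ^ 2 = a ^ 2 * (1 + 2 / p * s) := by
        rw [hs]
        field_simp
        ring
    _ ≤ a ^ 2 * (1 + s) ^ (2 / p) := by gcongr
    _ = (a ^ p * (1 + s)) ^ (2 / p) := by
        rw [Real.mul_rpow (by positivity) (by positivity), ← Real.rpow_mul ha.le,
          mul_div_cancel₀ _ hp0.ne', Real.rpow_two]
    _ ≤ 1 := Real.rpow_le_one (by positivity) hfactor (by positivity)
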